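/- Let s be a one-sided infinite sequence over a finite alphabet. If the complexity function satisfies p_s(n) ≤ n for some n ∈ ℕ, then s is ultimately periodic. -/

import Mathlib

/-- The complexity function `p_s(n)`: the number of distinct factors of length `n`
of the one-sided infinite word `s`. -/
noncomputable def complexity {A : Type*} (s : ℕ → A) (n : ℕ) : ℕ :=
  Set.ncard {w : Fin n → A | ∃ k : ℕ, ∀ i : Fin n, w i = s (k + i)}

/-- `s` is ultimately periodic: there are `N` and `p ≥ 1` with `s(k+p) = s(k)`
for all `k ≥ N`. -/
def UltimatelyPeriodic {A : Type*} (s : ℕ → A) : Prop :=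
  ∃ N p : ℕ, 1 ≤ p ∧ ∀ k, N ≤ k → s (k + p) = s k

/-- The factor of length `m` of `s` starting at position `k`. -/
def factorAt {A : Type*} (s : ℕ → A) (m k : ℕ) : Fin m → A := fun i => s (k + i)

theorem complexity_eq_ncard_range {A : Type*} (s : ℕ → A) (m : ℕ) :
    complexity s m = (Set.range (factorAt s m)).ncard := by
  unfold complexity
  congr 1
  ext w
  simp only [Set.mem_ofPred_eq, Set.mem_range, factorAt, funext_iff, eq_comm]

theorem complexity_zero {A : Type*} (s : ℕ → A) : complexity s 0 = 1 := by
  rw [complexity_eq_ncard_range, Set.ncard_eq_one]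
  exact ⟨factorAt s 0 0, Set.eq_singleton_iff_unique_mem.2
    ⟨⟨0, rfl⟩, fun _ _ => Subsingleton.elim _ _⟩⟩

theorem init_image_range_factorAt {A : Type*} (s : ℕ → A) (m : ℕ) :
    (Fin.init : (Fin (m + 1) → A) → Fin m → A) '' Set.range (factorAt s (m + 1)) =
      Set.range (factorAt s m) := by
  rw [← Set.range_comp]
  rfl

/-- If the complexity does not grow from `m` to `m + 1`, every factor of length `m` has a unique
right extension. -/
theorem factorAt_succ_eq_of_complexity_succ_le {A : Type*} [Finite A] {s : ℕ → A} {m : ℕ}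
    (hm : complexity s (m + 1) ≤ complexity s m) {k l : ℕ}
    (hkl : factorAt s m k = factorAt s m l) :
    factorAt s (m + 1) k = factorAt s (m + 1) l := by
  rw [complexity_eq_ncard_range, complexity_eq_ncard_range,
    ← init_image_range_factorAt s m] at hm
  have hfin := Set.toFinite (Set.range (factorAt s (m + 1)))
  exact Set.injOn_of_ncard_image_eq (le_antisymm (Set.ncard_image_le hfin) hm) hfin
    ⟨k, rfl⟩ ⟨l, rfl⟩ hkl

theorem ultimatelyPeriodic_of_complexity_succ_le {A : Type*} [Finite A] {s : ℕ → A} {m : ℕ}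
    (hm : complexity s (m + 1) ≤ complexity s m) : UltimatelyPeriodic s := by
  obtain ⟨a, b, hab, h⟩ := Finite.exists_ne_map_eq_of_infinite (factorAt s m)
  wlog hlt : a < b generalizing a b
  · exact this b a hab.symm h.symm (by omega)
  have key : ∀ j, factorAt s m (a + j) = factorAt s m (b + j) := by
    intro j
    induction j with
    | zero => exact h
    | succ j ih =>
      have h' := congrArg Fin.tail (factorAt_succ_eq_of_complexity_succ_le hm ih)
      funext i
      simpa [factorAt, Fin.tail, add_assoc, add_comm, add_left_comm] using congrFun h' i
  refine ⟨a + m, b - a, by omega, fun k hk => ?_⟩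
  have h' := congrFun (factorAt_succ_eq_of_complexity_succ_le hm (key (k - (a + m)))) (Fin.last m)
  simp only [factorAt, Fin.val_last] at h'
  convert h'.symm using 2 <;> omega

/-- Morse–Hedlund: if `p_s(n) ≤ n` for some `n`, then `s` is ultimately periodic. -/
theorem morse_hedlund {A : Type*} [Fintype A] (s : ℕ → A) (n : ℕ)
    (h : complexity s n ≤ n) : UltimatelyPeriodic s := by
  by_contra hs
  have hgrow : ∀ m, m < complexity s m := by
    intro m
    induction m with
    | zero => simp [complexity_zero]
    | succ m ih =>
      have : complexity s m < complexity s (m + 1) :=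
        not_le.1 fun hm => hs (ultimatelyPeriodic_of_complexity_succ_le hm)
      omega
  exact absurd h (not_le.2 (hgrow n))
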